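/- For every bounded measurable function f : S × A → ℝ, the expectation under the mixture measure η_μ^{π,p} can be written as a trajectory expectation: ∫ f dη_μ^{π,p} = ((1−γ)²/Z) · E_{τ∼ζ_μ^{π,p}}[ Σ_{t≥0} γ^t ( Σ_{l=0}^t ‖g(s_l,a_l)‖_q ) f(s_t,a_t) ], the series on the right converging absolutely. -/

import Mathlib

open MeasureTheory ProbabilityTheory
open scoped ENNReal

noncomputable section

variable {S A : Type*} [MeasurableSpace S] [MeasurableSpace A]

/-- The step kernel `K^{π,p}` on `S × A`: from `(s,a)`, draw `s' ~ p(·|s,a)` and then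
`a' ~ π(·|s')`. -/
def stepK (p : Kernel (S × A) S) (π : Kernel S A) : Kernel (S × A) (S × A) :=
  p ⊗ₖ Kernel.prodMkLeft (S × A) π

/-- `δ_t[m₀]`: the law of the time-`t` state–action pair of the Markov chain with initial
distribution `m₀` and transition kernel `K^{π,p}`. -/
def stepIter (p : Kernel (S × A) S) (π : Kernel S A) (m₀ : Measure (S × A)) :
    ℕ → Measure (S × A)
  | 0 => m₀
  | t + 1 => (stepIter p π m₀ t).bind (fun x => stepK p π x)

/-- The `γ`-discounted state–action distribution `δ^{π,p}[m₀] = (1-γ) ∑ₜ γ^t δ_t[m₀]`. -/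
def disc (p : Kernel (S × A) S) (π : Kernel S A) (γ : ℝ) (m₀ : Measure (S × A)) :
    Measure (S × A) :=
  Measure.sum fun t => ENNReal.ofReal ((1 - γ) * γ ^ t) • stepIter p π m₀ t

/-- The total-variation norm `‖m − m'‖_TV` of the difference of two (finite) measures.
For finite measures this supremum equals `|m − m'|(univ)`, i.e. the total variation of
the signed measure `m − m'`. -/
def tvDist {X : Type*} [MeasurableSpace X] (m m' : Measure X) : ℝ≥0∞ :=
  ⨆ (B : Set X) (_ : MeasurableSet B), ((m B - m' B) + (m' Bᶜ - m Bᶜ))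
/-- The law of the length-`(n+1)` prefix of the Markov chain on `X` with initial
distribution `m₀` and transition kernel `K` (the finite-dimensional distributions of the
Ionescu–Tulcea trajectory measure). -/
def prefixLaw {X : Type*} [MeasurableSpace X] (K : Kernel X X) (m₀ : Measure X) :
    (n : ℕ) → Measure (Fin (n + 1) → X)
  | 0 => m₀.map (fun x _ => x)
  | n + 1 =>
      ((prefixLaw K m₀ n) ⊗ₘ (K.comap (fun v => v (Fin.last n)) (measurable_pi_apply _))).map
        (fun va => Fin.snoc va.1 va.2)

/-- `ζ` is the trajectory law (Ionescu–Tulcea) of the Markov chain with initial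
distribution `m₀` and transition kernel `K`: its finite-dimensional prefix marginals are
given by `prefixLaw`. -/
def IsTrajLaw {X : Type*} [MeasurableSpace X] (K : Kernel X X) (m₀ : Measure X)
    (ζ : Measure (ℕ → X)) : Prop :=
  IsProbabilityMeasure ζ ∧
    ∀ n, ζ.map (fun τ => (fun i : Fin (n + 1) => τ i)) = prefixLaw K m₀ n
/-- The ℓ^q norm on ℝ^d. -/
def lqNorm (q : ℝ≥0∞) [Fact (1 ≤ q)] {d : ℕ} (v : Fin d → ℝ) : ℝ :=
  ‖(WithLp.equiv q (Fin d → ℝ)).symm v‖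

/-- The action of a kernel on nonnegative functions, `φ ↦ (x ↦ ∫⁻ y, φ y ∂K x)`. -/
def kernelLintegral {X : Type*} [MeasurableSpace X] (K : Kernel X X) (φ : X → ℝ≥0∞) (x : X) :
    ℝ≥0∞ :=
  ∫⁻ y, φ y ∂K x

lemma measurable_kernelLintegral {X : Type*} [MeasurableSpace X] (K : Kernel X X)
    {φ : X → ℝ≥0∞} (hφ : Measurable φ) : Measurable (kernelLintegral K φ) :=
  hφ.lintegral_kernel

lemma measurable_iterate_kernelLintegral {X : Type*} [MeasurableSpace X] (K : Kernel X X)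
    (k : ℕ) {φ : X → ℝ≥0∞} (hφ : Measurable φ) : Measurable ((kernelLintegral K)^[k] φ) := by
  induction k generalizing φ with
  | zero => exact hφ
  | succ k ih => exact ih (measurable_kernelLintegral K hφ)

/-- Markov property at time `n`, tested against a function of an earlier coordinate. -/
lemma IsTrajLaw.lintegral_mul_succ {X : Type*} [MeasurableSpace X] {K : Kernel X X}
    [IsMarkovKernel K] {m₀ : Measure X} {ζ : Measure (ℕ → X)} (hζ : IsTrajLaw K m₀ ζ)
    {φ h : X → ℝ≥0∞} (hφ : Measurable φ) (hh : Measurable h) {l n : ℕ} (hl : l ≤ n) :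
    ∫⁻ τ, φ (τ l) * h (τ (n + 1)) ∂ζ = ∫⁻ τ, φ (τ l) * kernelLintegral K h (τ n) ∂ζ := by
  have := hζ.1
  have hT := measurable_kernelLintegral K hh
  have hr : ∀ m : ℕ, Measurable (fun (τ : ℕ → X) (i : Fin (m + 1)) => τ i) := fun m => by fun_prop
  have hsnoc : Measurable
      (fun va : (Fin (n + 1) → X) × X => (Fin.snoc va.1 va.2 : Fin (n + 2) → X)) := by
    refine measurable_pi_iff.2 fun i => ?_
    refine Fin.lastCases ?_ (fun j => ?_) i
    · simpa using measurable_snd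
    · simp only [Fin.snoc_castSucc]
      fun_prop
  have hpn : IsProbabilityMeasure (prefixLaw K m₀ n) := by
    rw [← hζ.2 n]
    exact Measure.isProbabilityMeasure_map (hr n).aemeasurable
  have e1 : ∫⁻ τ, φ (τ l) * h (τ (n + 1)) ∂ζ
      = ∫⁻ v, φ (v (Fin.castSucc ⟨l, by omega⟩)) * h (v (Fin.last (n + 1)))
          ∂prefixLaw K m₀ (n + 1) := by
    rw [← hζ.2 (n + 1), lintegral_map (by fun_prop) (hr _)]
    rfl
  have e2 : ∫⁻ τ, φ (τ l) * kernelLintegral K h (τ n) ∂ζ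
      = ∫⁻ v, φ (v ⟨l, by omega⟩) * kernelLintegral K h (v (Fin.last n)) ∂prefixLaw K m₀ n := by
    rw [← hζ.2 n, lintegral_map (by fun_prop) (hr _)]
    rfl
  rw [e1, e2, prefixLaw, lintegral_map (by fun_prop) hsnoc]
  simp only [Fin.snoc_castSucc, Fin.snoc_last]
  rw [Measure.lintegral_compProd (by fun_prop)]
  refine lintegral_congr fun v => ?_
  exact lintegral_const_mul (φ (v ⟨l, _⟩)) hh

/-- Moving a later coordinate of the trajectory back to an earlier time. -/
lemma IsTrajLaw.lintegral_mul_add {X : Type*} [MeasurableSpace X] {K : Kernel X X}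
    [IsMarkovKernel K] {m₀ : Measure X} {ζ : Measure (ℕ → X)} (hζ : IsTrajLaw K m₀ ζ)
    {φ h : X → ℝ≥0∞} (hφ : Measurable φ) (hh : Measurable h) (l k : ℕ) :
    ∫⁻ τ, φ (τ l) * h (τ (l + k)) ∂ζ =
      ∫⁻ τ, φ (τ l) * (kernelLintegral K)^[k] h (τ l) ∂ζ := by
  induction k generalizing h with
  | zero => rfl
  | succ k ih =>
    rw [← add_assoc, hζ.lintegral_mul_succ hφ hh (Nat.le_add_right l k),
      ih (measurable_kernelLintegral K hh), Function.iterate_succ_apply]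

lemma IsTrajLaw.lintegral_zero {X : Type*} [MeasurableSpace X] {K : Kernel X X}
    {m₀ : Measure X} {ζ : Measure (ℕ → X)} (hζ : IsTrajLaw K m₀ ζ)
    {h : X → ℝ≥0∞} (hh : Measurable h) : ∫⁻ τ, h (τ 0) ∂ζ = ∫⁻ x, h x ∂m₀ := by
  have e : ∫⁻ τ, h (τ 0) ∂ζ = ∫⁻ v, h (v 0) ∂prefixLaw K m₀ 0 := by
    rw [← hζ.2 0, lintegral_map (by fun_prop) (by fun_prop)]
    rfl
  rw [e, prefixLaw, lintegral_map (by fun_prop) (by fun_prop)]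

instance (p : Kernel (S × A) S) [IsMarkovKernel p] (π : Kernel S A) [IsMarkovKernel π] :
    IsMarkovKernel (stepK p π) := by
  unfold stepK
  infer_instance

lemma lintegral_stepIter (p : Kernel (S × A) S) (π : Kernel S A) (m₀ : Measure (S × A)) (t : ℕ)
    {h : S × A → ℝ≥0∞} (hh : Measurable h) :
    ∫⁻ x, h x ∂stepIter p π m₀ t = ∫⁻ x, (kernelLintegral (stepK p π))^[t] h x ∂m₀ := by
  induction t generalizing h with
  | zero => rfl
  | succ t ih =>
    rw [stepIter, Measure.lintegral_bind (stepK p π).measurable.aemeasurable hh.aemeasurable,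
      Function.iterate_succ_apply]
    exact ih (measurable_kernelLintegral _ hh)

lemma isProbabilityMeasure_stepIter (p : Kernel (S × A) S) [IsMarkovKernel p] (π : Kernel S A)
    [IsMarkovKernel π] (m₀ : Measure (S × A)) [IsProbabilityMeasure m₀] (t : ℕ) :
    IsProbabilityMeasure (stepIter p π m₀ t) := by
  induction t with
  | zero => assumption
  | succ t ih =>
    exact isProbabilityMeasure_bind (stepK p π).measurable.aemeasurable
      (Filter.Eventually.of_forall fun _ => inferInstance)

/-- The law of the time-`t` coordinate of the trajectory. -/
lemma IsTrajLaw.lintegral_eval {p : Kernel (S × A) S} [IsMarkovKernel p] {π : Kernel S A}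
    [IsMarkovKernel π] {m₀ : Measure (S × A)} {ζ : Measure (ℕ → S × A)}
    (hζ : IsTrajLaw (stepK p π) m₀ ζ) (t : ℕ) {h : S × A → ℝ≥0∞} (hh : Measurable h) :
    ∫⁻ τ, h (τ t) ∂ζ = ∫⁻ x, h x ∂stepIter p π m₀ t := by
  have := hζ.lintegral_mul_add (φ := fun _ => 1) measurable_const hh 0 t
  simp only [one_mul, zero_add] at this
  rw [this, hζ.lintegral_zero (measurable_iterate_kernelLintegral _ t hh),
    lintegral_stepIter p π m₀ t hh]

lemma lintegral_disc (p : Kernel (S × A) S) (π : Kernel S A) (γ : ℝ) (m₀ : Measure (S × A))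
    (h : S × A → ℝ≥0∞) :
    ∫⁻ x, h x ∂disc p π γ m₀ =
      ∑' t : ℕ, ENNReal.ofReal ((1 - γ) * γ ^ t) * ∫⁻ x, h x ∂stepIter p π m₀ t := by
  simp [disc, lintegral_sum_measure]

lemma lintegral_disc_dirac (p : Kernel (S × A) S) (π : Kernel S A) (γ : ℝ) (x : S × A)
    {h : S × A → ℝ≥0∞} (hh : Measurable h) :
    ∫⁻ y, h y ∂disc p π γ (Measure.dirac x) =
      ∑' t : ℕ, ENNReal.ofReal ((1 - γ) * γ ^ t) * (kernelLintegral (stepK p π))^[t] h x := by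
  rw [lintegral_disc]
  refine tsum_congr fun t => ?_
  rw [lintegral_stepIter _ _ _ _ hh,
    lintegral_dirac' _ (measurable_iterate_kernelLintegral _ t hh)]

lemma measurable_disc_dirac (p : Kernel (S × A) S) (π : Kernel S A) (γ : ℝ) :
    Measurable fun x : S × A => disc p π γ (Measure.dirac x) := by
  refine Measure.measurable_of_measurable_coe _ fun B hB => ?_
  have hm : Measurable (B.indicator (1 : S × A → ℝ≥0∞)) := measurable_one.indicator hB
  simp_rw [← lintegral_indicator_one hB, lintegral_disc_dirac p π γ _ hm]
  exact Measurable.tsum fun t =>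
    (measurable_iterate_kernelLintegral _ t hm).const_mul _

lemma disc_apply_univ (p : Kernel (S × A) S) [IsMarkovKernel p] (π : Kernel S A)
    [IsMarkovKernel π] {γ : ℝ} (hγ0 : 0 ≤ γ) (hγ1 : γ < 1) (m₀ : Measure (S × A))
    [IsProbabilityMeasure m₀] : disc p π γ m₀ Set.univ = 1 := by
  have := isProbabilityMeasure_stepIter p π m₀
  have hs := (hasSum_geometric_of_lt_one hγ0 hγ1).mul_left (1 - γ)
  rw [mul_inv_cancel₀ (by linarith)] at hs
  rw [← lintegral_one, lintegral_disc]
  simp only [lintegral_one, measure_univ, mul_one]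
  rw [← ENNReal.ofReal_tsum_of_nonneg
    (fun t => mul_nonneg (by linarith) (pow_nonneg hγ0 t)) hs.summable, hs.tsum_eq,
    ENNReal.ofReal_one]

lemma ENNReal.tsum_sum_range_succ_eq (F : ℕ → ℕ → ℝ≥0∞) :
    ∑' t : ℕ, ∑ l ∈ Finset.range (t + 1), F l t = ∑' l : ℕ, ∑' k : ℕ, F l (l + k) := by
  have h1 := (Finset.HasAntidiagonal.sigmaAntidiagonalEquivProd (A := ℕ)).tsum_eq fun x =>
    F x.1 (x.1 + x.2)
  rw [← ENNReal.tsum_prod, ← h1, ENNReal.tsum_sigma']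
  refine tsum_congr fun t => ?_
  rw [tsum_fintype, Finset.univ_eq_attach]
  simp only [Finset.HasAntidiagonal.sigmaAntidiagonalEquivProd_apply]
  rw [Finset.sum_attach (Finset.HasAntidiagonal.antidiagonal t) fun x => F x.1 (x.1 + x.2),
    Finset.Nat.sum_antidiagonal_eq_sum_range_succ fun i j => F i (i + j)]
  refine Finset.sum_congr rfl fun l hl => ?_
  rw [Nat.add_sub_cancel' (by simpa [Nat.lt_succ_iff] using hl)]

/-- The trajectory representation of the mixture of discounted distributions, for nonnegative
weights and test functions. -/
lemma lintegral_bind_withDensity_disc {p : Kernel (S × A) S} [IsMarkovKernel p]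
    {π : Kernel S A} [IsMarkovKernel π] {γ : ℝ} (hγ0 : 0 ≤ γ) (hγ1 : γ < 1)
    {m₀ : Measure (S × A)} {ζ : Measure (ℕ → S × A)} (hζ : IsTrajLaw (stepK p π) m₀ ζ)
    {w h : S × A → ℝ≥0∞} (hw : Measurable w) (hh : Measurable h) :
    ∫⁻ x, h x ∂((disc p π γ m₀).withDensity w).bind (fun x => disc p π γ (Measure.dirac x)) =
      ENNReal.ofReal ((1 - γ) ^ 2) *
        ∫⁻ τ, ∑' t : ℕ, ENNReal.ofReal (γ ^ t) * (∑ l ∈ Finset.range (t + 1), w (τ l)) * h (τ t)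
          ∂ζ := by
  have hmT := fun k => measurable_iterate_kernelLintegral (stepK p π) k hh
  have hm : Measurable fun x => ∑' k : ℕ,
      ENNReal.ofReal ((1 - γ) * γ ^ k) * (kernelLintegral (stepK p π))^[k] h x :=
    Measurable.tsum fun k => (hmT k).const_mul _
  rw [Measure.lintegral_bind (measurable_disc_dirac p π γ).aemeasurable hh.aemeasurable]
  simp_rw [lintegral_disc_dirac p π γ _ hh]
  rw [lintegral_withDensity_eq_lintegral_mul _ hw hm, lintegral_disc]
  rw [lintegral_tsum fun t => by fun_prop]
  have hR : ∀ t : ℕ,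
      ∫⁻ τ, ENNReal.ofReal (γ ^ t) * (∑ l ∈ Finset.range (t + 1), w (τ l)) * h (τ t) ∂ζ =
      ∑ l ∈ Finset.range (t + 1), ENNReal.ofReal (γ ^ t) * ∫⁻ τ, w (τ l) * h (τ t) ∂ζ := by
    intro t
    simp_rw [mul_assoc, Finset.sum_mul]
    rw [lintegral_const_mul _ (by fun_prop), lintegral_finsetSum _ (fun l _ => by fun_prop),
      Finset.mul_sum]
  simp_rw [hR]
  rw [ENNReal.tsum_sum_range_succ_eq
    fun l t => ENNReal.ofReal (γ ^ t) * ∫⁻ τ, w (τ l) * h (τ t) ∂ζ, ← ENNReal.tsum_mul_left]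
  refine tsum_congr fun l => ?_
  simp only [Pi.mul_apply, ← ENNReal.tsum_mul_left]
  rw [lintegral_tsum (f := fun k x => w x *
      (ENNReal.ofReal ((1 - γ) * γ ^ k) * (kernelLintegral (stepK p π))^[k] h x))
      fun k => (hw.mul ((hmT k).const_mul _)).aemeasurable, ← ENNReal.tsum_mul_left]
  refine tsum_congr fun k => ?_
  have h1 : (0 : ℝ) ≤ 1 - γ := by linarith
  rw [hζ.lintegral_mul_add hw hh l k,
    hζ.lintegral_eval (h := fun x => w x * (kernelLintegral (stepK p π))^[k] h x) l
      (hw.mul (hmT k))]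
  simp_rw [mul_left_comm (w _)]
  rw [lintegral_const_mul (f := fun x => w x * (kernelLintegral (stepK p π))^[k] h x) _
    (hw.mul (hmT k)), ← mul_assoc, ← mul_assoc,
    ← ENNReal.ofReal_mul (by positivity), ← ENNReal.ofReal_mul (by positivity)]
  congr 2
  ring

lemma measurable_lqNorm {q : ℝ≥0∞} [Fact (1 ≤ q)] {d : ℕ} :
    Measurable (lqNorm q : (Fin d → ℝ) → ℝ) :=
  (continuous_norm.comp (PiLp.continuous_toLp q _)).measurable

/-- Expectations under the mixture measure `η_μ^{π,p}` as trajectory expectations: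
for every bounded measurable `f`,
`∫ f dη_μ^{π,p} = ((1−γ)²/Z) E_{τ∼ζ_μ^{π,p}}[∑ₜ γ^t (∑_{l≤t} ‖g(s_l,a_l)‖_q) f(s_t,a_t)]`,
the series on the right converging absolutely. -/
theorem eta_integral_as_traj_expectation
    (p : Kernel (S × A) S) [IsMarkovKernel p] (π : Kernel S A) [IsMarkovKernel π]
    (μ : Measure S) [IsProbabilityMeasure μ]
    (γ : ℝ) (hγ0 : 0 ≤ γ) (hγ1 : γ < 1)
    (d : ℕ) (hd : 1 ≤ d) (q : ℝ≥0∞) [Fact (1 ≤ q)]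
    (g : S × A → Fin d → ℝ) (hg : Measurable g)
    (Z : ℝ) (hZ : Z = ∫ x, lqNorm q (g x) ∂(disc p π γ (μ ⊗ₘ π)))
    (hZint : Integrable (fun x => lqNorm q (g x)) (disc p π γ (μ ⊗ₘ π)))
    (hZpos : 0 < Z)
    (ζ : Measure (ℕ → S × A)) (hζ : IsTrajLaw (stepK p π) (μ ⊗ₘ π) ζ)
    (f : S × A → ℝ) (hf : Measurable f) (hfb : ∃ C, ∀ x, |f x| ≤ C) :
    (∫⁻ τ, ∑' t : ℕ,
        ENNReal.ofReal (γ ^ t * (∑ l ∈ Finset.range (t + 1), lqNorm q (g (τ l))) * |f (τ t)|)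
          ∂ζ ≠ ⊤) ∧
      ∫ x, f x
          ∂(Measure.bind
              ((disc p π γ (μ ⊗ₘ π)).withDensity
                (fun x => ENNReal.ofReal (lqNorm q (g x) / Z)))
              (fun sa => disc p π γ (Measure.dirac sa))) =
        ((1 - γ) ^ 2 / Z) *
          ∫ τ, ∑' t : ℕ,
            γ ^ t * (∑ l ∈ Finset.range (t + 1), lqNorm q (g (τ l))) * f (τ t) ∂ζ := by
  obtain ⟨C, hC⟩ := hfb
  set m := disc p π γ (μ ⊗ₘ π)
  have hG0 : ∀ x, 0 ≤ lqNorm q (g x) := fun x => norm_nonneg _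
  have hG : Measurable fun x => lqNorm q (g x) := measurable_lqNorm.comp hg
  have hw : Measurable fun x => ENNReal.ofReal (lqNorm q (g x) / Z) :=
    (hG.div_const Z).ennreal_ofReal
  set ν := m.withDensity fun x => ENNReal.ofReal (lqNorm q (g x) / Z) with hν
  set η := ν.bind fun sa => disc p π γ (Measure.dirac sa) with hη
  set c : ℝ := (1 - γ) ^ 2 / Z with hc
  have hcpos : 0 < c := by
    have : 0 < 1 - γ := by linarith
    positivity
  let a : (S × A → ℝ) → ℕ → (ℕ → S × A) → ℝ := fun u t τ =>
    γ ^ t * (∑ l ∈ Finset.range (t + 1), lqNorm q (g (τ l))) * u (τ t)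
  have ham : ∀ u, Measurable u → ∀ t, Measurable (a u t) := fun u hu t => by
    refine ((Finset.measurable_sum _ fun l _ => ?_).const_mul _).mul
      (hu.comp (measurable_pi_apply t))
    exact hG.comp (measurable_pi_apply l)
  let Φ : (S × A → ℝ) → (ℕ → S × A) → ℝ≥0∞ := fun u τ => ∑' t, ENNReal.ofReal (a u t τ)
  have hΦm : ∀ u, Measurable u → Measurable (Φ u) := fun u hu =>
    Measurable.tsum fun t => (ham u hu t).ennreal_ofReal
  have hS0 : ∀ (t : ℕ) (τ : ℕ → S × A), 0 ≤ ∑ l ∈ Finset.range (t + 1), lqNorm q (g (τ l)) :=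
    fun t τ => Finset.sum_nonneg fun l _ => hG0 _
  have key : ∀ u, Measurable u →
      ∫⁻ x, ENNReal.ofReal (u x) ∂η = ENNReal.ofReal c * ∫⁻ τ, Φ u τ ∂ζ := by
    intro u hu
    rw [hη, lintegral_bind_withDensity_disc hγ0 hγ1 hζ hw hu.ennreal_ofReal, hc, div_eq_mul_inv,
      ENNReal.ofReal_mul (by positivity), mul_assoc, ← lintegral_const_mul _ (hΦm u hu)]
    congr 1
    refine lintegral_congr fun τ => ?_
    rw [← ENNReal.tsum_mul_left]
    refine tsum_congr fun t => ?_
    have hγt := pow_nonneg hγ0 t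
    rw [← ENNReal.ofReal_sum_of_nonneg fun l _ => div_nonneg (hG0 _) hZpos.le,
      ← ENNReal.ofReal_mul hγt, ← ENNReal.ofReal_mul (mul_nonneg hγt
        (Finset.sum_nonneg fun l _ => div_nonneg (hG0 _) hZpos.le)),
      ← ENNReal.ofReal_mul (by positivity), ← Finset.sum_div]
    congr 1
    simp only [a]
    ring
  have hηfin : IsFiniteMeasure η := by
    refine ⟨?_⟩
    rw [hη, Measure.bind_apply MeasurableSet.univ (measurable_disc_dirac p π γ).aemeasurable]
    simp_rw [disc_apply_univ p π hγ0 hγ1]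
    rw [lintegral_one, hν, withDensity_apply _ MeasurableSet.univ, Measure.restrict_univ]
    exact (hZint.div_const Z).lintegral_lt_top
  have hΦabs : ∫⁻ τ, Φ (fun x => |f x|) τ ∂ζ ≠ ⊤ := by
    have h1 : ∫⁻ x, ENNReal.ofReal |f x| ∂η ≠ ⊤ := by
      refine ne_top_of_le_ne_top (b := ENNReal.ofReal C * η Set.univ)
        (ENNReal.mul_ne_top ENNReal.ofReal_ne_top (measure_ne_top _ _)) ?_
      rw [← lintegral_const]
      exact lintegral_mono fun x => ENNReal.ofReal_le_ofReal (hC x)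
    rw [key _ hf.abs] at h1
    intro h
    rw [h, ENNReal.mul_top (by simpa using hcpos)] at h1
    exact h1 rfl
  refine ⟨hΦabs, ?_⟩
  have hle : ∀ u : S × A → ℝ, (∀ x, u x ≤ |f x|) → ∀ τ, Φ u τ ≤ Φ (fun x => |f x|) τ :=
    fun u hu τ => ENNReal.tsum_le_tsum fun t => ENNReal.ofReal_le_ofReal <|
      mul_le_mul_of_nonneg_left (hu _) (mul_nonneg (pow_nonneg hγ0 t) (hS0 t τ))
  have hfle := hle f fun x => le_abs_self _
  have hnle := hle (fun x => -f x) fun x => neg_le_abs _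
  have hfin := ne_top_of_le_ne_top hΦabs (lintegral_mono hfle)
  have hnin := ne_top_of_le_ne_top hΦabs (lintegral_mono hnle)
  have hfm := hΦm f hf
  have hnm := hΦm (fun x => -f x) hf.neg
  have hfint : Integrable f η :=
    Integrable.of_bound hf.aestronglyMeasurable C (Filter.Eventually.of_forall hC)
  have hae : (fun τ => ∑' t, a f t τ) =ᵐ[ζ]
      fun τ => (Φ f τ).toReal - (Φ (fun x => -f x) τ).toReal := by
    filter_upwards [ae_lt_top (hΦm _ hf.abs) hΦabs] with τ hτ
    have h1 : Φ f τ ≠ ⊤ := ne_top_of_le_ne_top hτ.ne (hfle τ)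
    have h2 : Φ (fun x => -f x) τ ≠ ⊤ := ne_top_of_le_ne_top hτ.ne (hnle τ)
    rw [ENNReal.tsum_toReal_eq fun t => ENNReal.ofReal_ne_top,
      ENNReal.tsum_toReal_eq fun t => ENNReal.ofReal_ne_top,
      ← (ENNReal.summable_toReal h1).tsum_sub (ENNReal.summable_toReal h2)]
    refine tsum_congr fun t => ?_
    have hneg : a (fun x => -f x) t τ = -a f t τ := mul_neg _ _
    rw [hneg, ENNReal.toReal_ofReal', ENNReal.toReal_ofReal']
    exact (max_zero_sub_max_neg_zero_eq_self _).symm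
  have hrhs : ∫ τ, ∑' t, a f t τ ∂ζ =
      (∫⁻ τ, Φ f τ ∂ζ).toReal - (∫⁻ τ, Φ (fun x => -f x) τ ∂ζ).toReal := by
    rw [integral_congr_ae hae, integral_sub
      (integrable_toReal_of_lintegral_ne_top hfm.aemeasurable hfin)
      (integrable_toReal_of_lintegral_ne_top hnm.aemeasurable hnin),
      integral_toReal hfm.aemeasurable (ae_lt_top hfm hfin),
      integral_toReal hnm.aemeasurable (ae_lt_top hnm hnin)]
  rw [integral_eq_lintegral_pos_part_sub_lintegral_neg_part hfint, key f hf, key (fun x => -f x) hf.neg,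
    ENNReal.toReal_mul, ENNReal.toReal_mul, ENNReal.toReal_ofReal hcpos.le, ← mul_sub]
  exact congrArg _ hrhs.symm

end
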